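/- (Stabilized bound under one-sided control) In the setting of the one-control closed-loop system, let C₁' = max(C₁, ‖h‖_∞), D₁ = ‖∂_v h‖_∞, D₂ = ‖∂_t h‖_∞ over (-C₁,C₁)×(0,∞), and define C₃' = max(KC₁^γ/c, C₂)·max(1,M₁)·exp(2TM₂C₃) and C₃'' = max((D₁C₃' + D₂)/c, C₂)·max(1,M₁)·exp(2TM₂C₃). If C₃' ≤ C₃ and C₃'' ≤ C₃, then the map F sending (ũ,ṽ) to the pair (u,v) of linear transport solutions with boundary data u(t,0) = h(ṽ(t,0),t) and v(t,1) = v_r(t) maps the set D = {(u,v) Lipschitz : ‖u‖_∞ ≤ C₁', ‖v‖_∞ ≤ C₁, u is C₃-Lipschitz, v is C₃'-Lipschitz} into itself. -/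

import Mathlib

open MeasureTheory

/-- A vector field on the line that is Lipschitz in space and time and bounded has a solution
through every point, differentiable up to the ends of a given time interval. -/
lemma exists_characteristic {a : ℝ → ℝ → ℝ} {L M : ℝ}
    (ha : ∀ s y s' y', |a s y - a s' y'| ≤ L * (|s - s'| + |y - y'|))
    (hM : ∀ s y, |a s y| ≤ M) {t : ℝ} (ht : 0 ≤ t) (x : ℝ) :
    ∃ X : ℝ → ℝ, X t = x ∧ ∀ s ∈ Set.Icc 0 t, HasDerivAt X (a s (X s)) s := by
  have hM0 : 0 ≤ M := (abs_nonneg _).trans (hM 0 0)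
  have hL0 : 0 ≤ L := by
    have := (abs_nonneg _).trans (ha 1 0 0 0)
    simpa using this
  lift L to NNReal using hL0
  have htm : t ∈ Set.Icc (-1 : ℝ) (t + 1) := ⟨by linarith, by linarith⟩
  have hPL : IsPicardLindelof a (tmin := -1) (tmax := t + 1) ⟨t, htm⟩ x
      ⟨M * (t + 1), by positivity⟩ 0 ⟨M, hM0⟩ L := by
    refine ⟨fun s _ => ?_, fun y _ => ?_, fun s _ y _ => ?_, ?_⟩
    · refine LipschitzWith.lipschitzOnWith (LipschitzWith.of_dist_le_mul fun y y' => ?_)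
      have := ha s y s y'
      simpa [Real.dist_eq] using this
    · refine (LipschitzWith.of_dist_le_mul (K := L) fun s s' => ?_).continuous.continuousOn
      have := ha s y s' y
      simpa [Real.dist_eq] using this
    · exact hM s y
    · have : max (t + 1 - t) (t - -1) = t + 1 := by
        rw [max_eq_right] <;> linarith
      show M * max (t + 1 - t) (t - -1) ≤ M * (t + 1) - 0
      rw [this, sub_zero]
  obtain ⟨X, hX, hX'⟩ := hPL.exists_eq_forall_mem_Icc_hasDerivWithinAt₀
  refine ⟨X, hX, fun s hs => (hX' s ⟨by linarith [hs.1], by linarith [hs.2]⟩).hasDerivAt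
    (Icc_mem_nhds (by linarith [hs.1]) (by linarith [hs.2]))⟩

/-- Two solutions of the same Lipschitz ODE separate at most exponentially backwards in time. -/
lemma characteristic_dist_le {a : ℝ → ℝ → ℝ} {L : ℝ}
    (ha : ∀ s y s' y', |a s y - a s' y'| ≤ L * (|s - s'| + |y - y'|)) {t : ℝ} {X₁ X₂ : ℝ → ℝ}
    (h₁ : ∀ s ∈ Set.Icc 0 t, HasDerivAt X₁ (a s (X₁ s)) s)
    (h₂ : ∀ s ∈ Set.Icc 0 t, HasDerivAt X₂ (a s (X₂ s)) s) {s : ℝ} (hs : s ∈ Set.Icc 0 t) :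
    |X₁ s - X₂ s| ≤ |X₁ t - X₂ t| * Real.exp (L * (t - s)) := by
  have hL0 : 0 ≤ L := by
    have := (abs_nonneg _).trans (ha 1 0 0 0)
    simpa using this
  lift L to NNReal using hL0
  have key : ∀ X : ℝ → ℝ, (∀ s ∈ Set.Icc 0 t, HasDerivAt X (a s (X s)) s) →
      ∀ r ∈ Set.Icc 0 t, HasDerivAt (fun r => X (t - r)) (-a (t - r) (X (t - r))) r := by
    intro X hX r hr
    have := (hX (t - r) ⟨by linarith [hr.2], by linarith [hr.1]⟩).comp r
      ((hasDerivAt_id r).const_sub t)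
    simpa [Function.comp_def] using this
  have := dist_le_of_trajectories_ODE (K := L) (a := 0) (b := t)
    (v := fun r y => -a (t - r) y) (f := fun r => X₁ (t - r)) (g := fun r => X₂ (t - r))
    (δ := |X₁ t - X₂ t|)
    (fun r => LipschitzWith.of_dist_le_mul fun y y' => by
      have := ha (t - r) y (t - r) y'
      rw [dist_neg_neg]
      simpa [Real.dist_eq] using this)
    (fun r hr => (key X₁ h₁ r hr).continuousAt.continuousWithinAt)
    (fun r hr => (key X₁ h₁ r (Set.Ico_subset_Icc_self hr)).hasDerivWithinAt)
    (fun r hr => (key X₂ h₂ r hr).continuousAt.continuousWithinAt)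
    (fun r hr => (key X₂ h₂ r (Set.Ico_subset_Icc_self hr)).hasDerivWithinAt)
    (by simp [Real.dist_eq]) (t - s) ⟨by linarith [hs.2], by linarith [hs.1]⟩
  simpa [Real.dist_eq] using this

/-- A Lipschitz function whose derivative is almost everywhere bounded by `B` is `B`-Lipschitz. -/
lemma abs_sub_le_of_ae_hasDerivAt_le {g : ℝ → ℝ} {K : NNReal} (hg : LipschitzWith K g) {δ B : ℝ}
    (hδ : 0 ≤ δ) (hB : ∀ᵐ s, s ∈ Set.Ioo 0 δ → ∃ g', HasDerivAt g g' s ∧ |g'| ≤ B) :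
    |g δ - g 0| ≤ B * δ := by
  have hAC := (hg.lipschitzOnWith (s := Set.uIcc 0 δ)).absolutelyContinuousOnInterval
  rw [← hAC.integral_deriv_eq_sub]
  have := intervalIntegral.norm_integral_le_of_norm_le_const_ae (a := 0) (b := δ) (C := B)
    (f := deriv g) (by
      filter_upwards [hB, compl_mem_ae_iff.2 (measure_singleton δ)] with s hs hsδ hmem
      rw [Set.uIoc_of_le hδ] at hmem
      obtain ⟨g', hg', hle⟩ := hs ⟨hmem.1, lt_of_le_of_ne hmem.2 hsδ⟩
      rw [hg'.deriv]
      exact hle)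
  simpa [abs_of_nonneg hδ] using this

/-- A property valid at almost every point of the plane holds at almost every point of almost
every line of a given non-vertical direction. -/
lemma ae_ae_shear {P : ℝ × ℝ → Prop} (hP : ∀ᵐ p, P p) (t α : ℝ) :
    ∀ᵐ y : ℝ, ∀ᵐ s : ℝ, P (t + s, y + α * s) := by
  have h : MeasurePreserving (fun p : ℝ × ℝ => (t + p.1, p.2 + α * p.1))
      (volume.prod volume) (volume.prod volume) :=
    (measurePreserving_add_left volume t).skew_product (g := fun s y => y + α * s)
      (by unfold Function.uncurry; fun_prop)
      (Filter.Eventually.of_forall fun s => (measurePreserving_add_right volume (α * s)).map_eq)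
  have h' := h.comp Measure.measurePreserving_swap
  exact Measure.ae_ae_of_ae_prod (h'.quasiMeasurePreserving.ae hP)

/-- A Lipschitz bound in the `ℓ¹` metric of the plane gives one in the `ℓ^∞` metric. -/
lemma lipschitzWith_uncurry {w : ℝ → ℝ → ℝ} {C : ℝ}
    (hw : ∀ t x t' x', |w t x - w t' x'| ≤ C * (|t - t'| + |x - x'|)) :
    LipschitzWith (2 * C).toNNReal (fun p : ℝ × ℝ => w p.1 p.2) := by
  have hC : 0 ≤ C := by
    have := (abs_nonneg _).trans (hw 1 0 0 0)
    simpa using this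
  refine LipschitzWith.of_dist_le_mul fun p q => ?_
  rw [Real.coe_toNNReal _ (by positivity), Real.dist_eq]
  have h₁ : |p.1 - q.1| ≤ dist p q := by
    rw [← Real.dist_eq]; exact le_max_left _ _
  have h₂ : |p.2 - q.2| ≤ dist p q := by
    rw [← Real.dist_eq]; exact le_max_right _ _
  calc |w p.1 p.2 - w q.1 q.2| ≤ C * (|p.1 - q.1| + |p.2 - q.2|) := hw _ _ _ _
    _ ≤ C * (dist p q + dist p q) := by gcongr
    _ = 2 * C * dist p q := by ring

/-- The function `w` solves the linear transport equation `∂ₜw + a ∂ₓw = 0` almost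
everywhere in `(0,T) × (0,1)`. -/
def IsTransportSolution (T : ℝ) (a w : ℝ → ℝ → ℝ) : Prop :=
  ∀ᵐ p : ℝ × ℝ, p ∈ Set.Ioo (0 : ℝ) T ×ˢ Set.Ioo (0 : ℝ) 1 →
    ∃ wT wX : ℝ, HasDerivAt (fun τ => w τ p.2) wT p.1 ∧ HasDerivAt (fun ξ => w p.1 ξ) wX p.2 ∧
      wT + a p.1 p.2 * wX = 0

/-- Along a straight line tangent to the characteristic direction at its starting point, a
Lipschitz solution of the transport equation varies quadratically. -/
lemma IsTransportSolution.exists_quadratic_bound {T c L M C : ℝ} {a w : ℝ → ℝ → ℝ} (hc : 0 < c)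
    (ha : ∀ s y s' y', |a s y - a s' y'| ≤ L * (|s - s'| + |y - y'|))
    (hac : ∀ s y, c ≤ a s y) (haM : ∀ s y, a s y ≤ M)
    (hw : ∀ t x t' x', |w t x - w t' x'| ≤ C * (|t - t'| + |x - x'|))
    (h : IsTransportSolution T a w) :
    ∃ κ : ℝ, ∀ t x δ : ℝ, 0 ≤ t → 0 ≤ x → 0 < δ → t + δ ≤ T → x + a t x * δ < 1 →
      |w (t + δ) (x + a t x * δ) - w t x| ≤ κ * δ ^ 2 := by
  have hlip := lipschitzWith_uncurry hw
  set K := (2 * C).toNNReal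
  have hL0 : 0 ≤ L := by
    have := (abs_nonneg _).trans (ha 1 0 0 0)
    simpa using this
  have hM0 : 0 ≤ M := hc.le.trans ((hac 0 0).trans (haM 0 0))
  refine ⟨K * L * (1 + M), fun t x δ ht hx hδ hT h1 => ?_⟩
  set α := a t x with hα
  have hα0 : 0 < α := hc.trans_le (hac t x)
  have hgood := ae_ae_shear (hlip.ae_differentiableAt.and h) t α
  -- the estimate on the parallel line through almost every nearby point
  have hline : ∀ y, x < y → y + α * δ < 1 →
      (∀ᵐ s : ℝ, DifferentiableAt ℝ (fun p : ℝ × ℝ => w p.1 p.2) (t + s, y + α * s) ∧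
        ((t + s, y + α * s) ∈ Set.Ioo (0 : ℝ) T ×ˢ Set.Ioo (0 : ℝ) 1 →
          ∃ wT wX : ℝ, HasDerivAt (fun τ => w τ (y + α * s)) wT (t + s) ∧
            HasDerivAt (fun ξ => w (t + s) ξ) wX (y + α * s) ∧
            wT + a (t + s) (y + α * s) * wX = 0)) →
      |w (t + δ) (y + α * δ) - w t y| ≤ K * (L * (δ + (y - x + M * δ))) * δ := by
    intro y hxy hy1 hae
    have hcurve : LipschitzWith (1 + α.toNNReal) (fun s : ℝ => (t + s, y + α * s)) := by
      refine LipschitzWith.of_dist_le_mul fun s s' => ?_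
      rw [Prod.dist_eq, Real.dist_eq, Real.dist_eq, Real.dist_eq, NNReal.coe_add,
        Real.coe_toNNReal _ hα0.le, NNReal.coe_one]
      have e₁ : t + s - (t + s') = s - s' := by ring
      have e₂ : y + α * s - (y + α * s') = α * (s - s') := by ring
      dsimp only
      rw [e₁, e₂, abs_mul, abs_of_pos hα0]
      have := abs_nonneg (s - s')
      exact max_le (by nlinarith) (by nlinarith)
    have := abs_sub_le_of_ae_hasDerivAt_le (hlip.comp hcurve) hδ.le
      (B := K * (L * (δ + (y - x + M * δ)))) (by
        filter_upwards [hae] with s hs hsmem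
        have hs0 : 0 < s := hsmem.1
        have hsδ : s < δ := hsmem.2
        have hαs : α * s ≤ α * δ := by gcongr
        have hαs0 : 0 < α * s := by positivity
        obtain ⟨hdiff, hpde⟩ := hs
        obtain ⟨wT, wX, hwT, hwX, heq⟩ := hpde
          ⟨⟨by simp only; linarith, by simp only; linarith⟩,
            ⟨by simp only; linarith, by simp only; linarith⟩⟩
        set D := fderiv ℝ (fun p : ℝ × ℝ => w p.1 p.2) (t + s, y + α * s) with hD
        have hDT : HasDerivAt (fun τ => w τ (y + α * s)) (D (1, 0)) (t + s) :=
          hdiff.hasFDerivAt.comp_hasDerivAt (f := fun τ => (τ, y + α * s)) (t + s)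
            ((hasDerivAt_id (t + s)).prodMk (hasDerivAt_const (t + s) (y + α * s)))
        have hDX : HasDerivAt (fun ξ => w (t + s) ξ) (D (0, 1)) (y + α * s) :=
          hdiff.hasFDerivAt.comp_hasDerivAt (f := fun ξ => (t + s, ξ)) (y + α * s)
            ((hasDerivAt_const (y + α * s) (t + s)).prodMk (hasDerivAt_id (y + α * s)))
        replace hDT := hDT.unique hwT
        replace hDX := hDX.unique hwX
        have hline : HasDerivAt (fun s : ℝ => (t + s, y + α * s)) (1, α) s := by
          have h₁ := (hasDerivAt_id s).const_add t
          have h₂ := ((hasDerivAt_id s).const_mul α).const_add y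
          simpa using h₁.prodMk h₂
        refine ⟨D (1, α), hdiff.hasFDerivAt.comp_hasDerivAt s hline, ?_⟩
        have hsplit : D (1, α) = (α - a (t + s) (y + α * s)) * wX := by
          have : ((1, α) : ℝ × ℝ) = (1, 0) + α • (0, 1) := by simp
          rw [this, map_add, map_smul, hDT, hDX, smul_eq_mul]
          linarith
        have hwXle : |wX| ≤ K := by
          rw [← hDX, ← Real.norm_eq_abs]
          refine (D.le_opNorm _).trans ?_
          have hn : ‖((0, 1) : ℝ × ℝ)‖ = 1 := by simp [Prod.norm_def]
          rw [hn, mul_one]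
          exact norm_fderiv_le_of_lipschitz ℝ hlip
        have hale : |α - a (t + s) (y + α * s)| ≤ L * (δ + (y - x + M * δ)) := by
          refine (ha t x (t + s) (y + α * s)).trans ?_
          have e₁ : |t - (t + s)| = s := by
            rw [show t - (t + s) = -s by ring, abs_neg, abs_of_pos hs0]
          have e₂ : |x - (y + α * s)| = y - x + α * s := by
            rw [abs_of_neg (by linarith)]; ring
          have hMs : α * s ≤ M * δ := hαs.trans (by gcongr; exact haM t x)
          rw [e₁, e₂]
          gcongr
        rw [hsplit, abs_mul, mul_comm (K : ℝ)]
        gcongr)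
    simpa [Function.comp_def] using this
  set S := {y : ℝ | 0 ≤ K * (L * (δ + (y - x + M * δ))) * δ -
    |w (t + δ) (y + α * δ) - w t y|} with hS
  have hSclosed : IsClosed S := by
    have h₁ : Continuous fun y => w (t + δ) (y + α * δ) :=
      hlip.continuous.comp (f := fun y => (t + δ, y + α * δ)) (by fun_prop)
    have h₂ : Continuous fun y => w t y := hlip.continuous.comp (f := fun y => (t, y)) (by fun_prop)
    have h₃ : Continuous fun y => K * (L * (δ + (y - x + M * δ))) * δ := by fun_prop
    exact isClosed_Ici.preimage (h₃.sub (h₁.sub h₂).abs)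
  have hxS : x ∈ S := by
    have hx1 : x < 1 - α * δ := by linarith
    have hsub : Set.Ioo x (1 - α * δ) ⊆ S := by
      rw [← hSclosed.closure_eq]
      refine ((Measure.dense_of_ae hgood).open_subset_closure_inter isOpen_Ioo).trans
        (closure_mono ?_)
      rintro y ⟨hy, hyg⟩
      exact sub_nonneg.2 (hline y hy.1 (by linarith [hy.2]) hyg)
    have := closure_minimal hsub hSclosed
    rw [closure_Ioo hx1.ne] at this
    exact this ⟨le_rfl, hx1.le⟩
  calc _ ≤ _ := sub_nonneg.1 hxS
    _ = _ := by ring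

/-- Lipschitz solutions of the transport equation are constant along characteristics. -/
lemma IsTransportSolution.eq_along_characteristic {T c L M C : ℝ} {a w : ℝ → ℝ → ℝ} (hc : 0 < c)
    (ha : ∀ s y s' y', |a s y - a s' y'| ≤ L * (|s - s'| + |y - y'|))
    (hac : ∀ s y, c ≤ a s y) (haM : ∀ s y, a s y ≤ M)
    (hw : ∀ t x t' x', |w t x - w t' x'| ≤ C * (|t - t'| + |x - x'|))
    (h : IsTransportSolution T a w) {τ t : ℝ} (hτ : 0 ≤ τ) (hτt : τ ≤ t) (htT : t ≤ T)
    {X : ℝ → ℝ} (hX : ∀ s ∈ Set.Icc τ t, HasDerivAt X (a s (X s)) s) (hXτ : 0 ≤ X τ)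
    (hXt : X t ≤ 1) : w t (X t) = w τ (X τ) := by
  obtain ⟨κ, hκ⟩ := h.exists_quadratic_bound hc ha hac haM hw
  have hlip := lipschitzWith_uncurry hw
  have hXcont : ContinuousOn X (Set.Icc τ t) := fun s hs => (hX s hs).continuousAt.continuousWithinAt
  have hmono : StrictMonoOn X (Set.Icc τ t) := by
    refine strictMonoOn_of_deriv_pos (convex_Icc _ _) hXcont fun s hs => ?_
    rw [(hX s (interior_subset hs)).deriv]
    exact hc.trans_le (hac _ _)
  refine constant_of_has_deriv_right_zero (f := fun s => w s (X s))
    (hlip.continuous.comp_continuousOn (f := fun s => (s, X s)) (continuousOn_id.prodMk hXcont))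
    (fun s hs => ?_) t ⟨hτt, le_rfl⟩
  have hs' := Set.Ico_subset_Icc_self hs
  have hs0 : 0 ≤ s := hτ.trans hs.1
  have hXs0 : 0 ≤ X s := hXτ.trans (hmono.monotoneOn ⟨le_rfl, hτt⟩ hs' hs.1)
  have hXs1 : X s < 1 := (hmono hs' ⟨hτt, le_rfl⟩ hs.2).trans_le hXt
  -- split the increment into the tangent line and the deviation from it
  have h₁ : (fun r => w r (X r) - w r (X s + a s (X s) * (r - s))) =o[nhdsWithin s (Set.Ici s)]
      fun r => r - s := by
    have hd := (hasDerivAt_iff_isLittleO.1 (hX s hs')).mono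
      (nhdsWithin_le_nhds (s := Set.Ici s))
    refine Asymptotics.IsBigO.trans_isLittleO (Asymptotics.IsBigO.of_bound C ?_) hd
    refine Filter.Eventually.of_forall fun r => ?_
    have := hw r (X r) r (X s + a s (X s) * (r - s))
    rw [sub_self, abs_zero, zero_add] at this
    rw [Real.norm_eq_abs, Real.norm_eq_abs, smul_eq_mul]
    convert this using 3
    ring
  have h₂ : (fun r => w r (X s + a s (X s) * (r - s)) - w s (X s)) =o[nhdsWithin s (Set.Ici s)]
      fun r => r - s := by
    have hsq : (fun r : ℝ => (r - s) ^ 2) =o[nhdsWithin s (Set.Ici s)] fun r => r - s := by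
      have : (fun r : ℝ => (r - s) ^ 2) =o[nhds s] fun r => r - s := by
        have := (Asymptotics.isLittleO_pow_id (𝕜 := ℝ) (n := 2) (by norm_num)).comp_tendsto
          (show Filter.Tendsto (fun r : ℝ => r - s) (nhds s) (nhds 0) from by
            simpa using (continuous_id.sub continuous_const).tendsto (f := fun r : ℝ => r - s) s)
        exact this
      exact this.mono nhdsWithin_le_nhds
    refine Asymptotics.IsBigO.trans_isLittleO (Asymptotics.IsBigO.of_bound κ ?_) hsq
    have hev₁ : ∀ᶠ r in nhdsWithin s (Set.Ici s), r < t :=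
      nhdsWithin_le_nhds (Iio_mem_nhds hs.2)
    have hev₂ : ∀ᶠ r in nhdsWithin s (Set.Ici s), X s + a s (X s) * (r - s) < 1 := by
      refine nhdsWithin_le_nhds (ContinuousAt.eventually_lt (by fun_prop) continuousAt_const ?_)
      simpa using hXs1
    filter_upwards [hev₁, hev₂, self_mem_nhdsWithin] with r hr₁ hr₂ hr₃
    rcases eq_or_lt_of_le (show s ≤ r from hr₃) with rfl | hlt
    · simp
    · have := hκ s (X s) (r - s) hs0 hXs0 (sub_pos.2 hlt) (by linarith) hr₂
      rw [add_sub_cancel] at this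
      rw [Real.norm_eq_abs, Real.norm_eq_abs, abs_of_nonneg (sq_nonneg (r - s))]
      exact this
  rw [hasDerivWithinAt_iff_isLittleO]
  refine (h₁.add h₂).congr_left fun r => ?_
  simp

/-- Every point with `t₀ ≤ t` and `0 ≤ x` is joined by a characteristic to a foot on the line
`t = t₀` or on the inflow boundary `x = 0`. -/
lemma exists_characteristic_foot {c L M : ℝ} {a : ℝ → ℝ → ℝ} (hc : 0 < c)
    (ha : ∀ s y s' y', |a s y - a s' y'| ≤ L * (|s - s'| + |y - y'|))
    (hac : ∀ s y, c ≤ a s y) (haM : ∀ s y, a s y ≤ M) {t₀ t x : ℝ} (ht₀ : 0 ≤ t₀) (ht : t₀ ≤ t)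
    (hx : 0 ≤ x) :
    ∃ X : ℝ → ℝ, X t = x ∧ (∀ s ∈ Set.Icc 0 t, HasDerivAt X (a s (X s)) s) ∧
      ∃ τ ∈ Set.Icc t₀ t, 0 ≤ X τ ∧ (τ = t₀ ∨ X τ = 0) := by
  obtain ⟨X, hXt, hX⟩ := exists_characteristic ha
    (fun s y => abs_le.2 ⟨by linarith [hac s y, hac 0 0, haM 0 0], haM s y⟩) (ht₀.trans ht) x
  refine ⟨X, hXt, hX, ?_⟩
  by_cases h0 : 0 ≤ X t₀
  · exact ⟨t₀, ⟨le_rfl, ht⟩, h0, Or.inl rfl⟩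
  · have hcont : ContinuousOn X (Set.Icc t₀ t) := fun s hs =>
      (hX s ⟨ht₀.trans hs.1, hs.2⟩).continuousAt.continuousWithinAt
    obtain ⟨τ, hτ, hτ0⟩ := intermediate_value_Icc ht hcont
      (show (0 : ℝ) ∈ Set.Icc (X t₀) (X t) from ⟨by linarith, by linarith⟩)
    exact ⟨τ, hτ, hτ0.ge, Or.inr hτ0⟩

/-- Bounds on the speed of a characteristic give bounds on its increments. -/
lemma characteristic_increment {c M : ℝ} {a : ℝ → ℝ → ℝ} (hac : ∀ s y, c ≤ a s y)
    (haM : ∀ s y, a s y ≤ M) {t : ℝ} {X : ℝ → ℝ}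
    (hX : ∀ s ∈ Set.Icc 0 t, HasDerivAt X (a s (X s)) s) {s r : ℝ} (hs : 0 ≤ s) (hsr : s ≤ r)
    (hr : r ≤ t) : c * (r - s) ≤ X r - X s ∧ X r - X s ≤ M * (r - s) := by
  have hcont : ContinuousOn X (Set.Icc 0 t) := fun s hs => (hX s hs).continuousAt.continuousWithinAt
  have hdiff : DifferentiableOn ℝ X (interior (Set.Icc 0 t)) := fun s hs =>
    (hX s (interior_subset hs)).differentiableAt.differentiableWithinAt
  have hs' : s ∈ Set.Icc 0 t := ⟨hs, hsr.trans hr⟩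
  have hr' : r ∈ Set.Icc 0 t := ⟨hs.trans hsr, hr⟩
  exact ⟨(convex_Icc 0 t).mul_sub_le_image_sub_of_le_deriv hcont hdiff
      (fun y hy => by rw [(hX y (interior_subset hy)).deriv]; exact hac _ _) s hs' r hr' hsr,
    (convex_Icc 0 t).image_sub_le_mul_sub_of_deriv_le hcont hdiff
      (fun y hy => by rw [(hX y (interior_subset hy)).deriv]; exact haM _ _) s hs' r hr' hsr⟩

/-- Sup and Lipschitz bounds for Lipschitz solutions of the linear transport equation with positive
speed, in terms of the initial and boundary data. -/
lemma IsTransportSolution.bounds {T c L M C B b C₂ : ℝ} {a w : ℝ → ℝ → ℝ} (hT : 0 ≤ T)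
    (hc : 0 < c)
    (ha : ∀ s y s' y', |a s y - a s' y'| ≤ L * (|s - s'| + |y - y'|))
    (hac : ∀ s y, c ≤ a s y) (haM : ∀ s y, a s y ≤ M)
    (hw : ∀ t x t' x', |w t x - w t' x'| ≤ C * (|t - t'| + |x - x'|))
    (h : IsTransportSolution T a w)
    (hb : ∀ t ∈ Set.Icc 0 T, |w t 0| ≤ B) (hi : ∀ x ∈ Set.Icc (0 : ℝ) 1, |w 0 x| ≤ B)
    (hb' : ∀ t ∈ Set.Icc 0 T, ∀ t' ∈ Set.Icc 0 T, |w t 0 - w t' 0| ≤ b * |t - t'|)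
    (hi' : ∀ x ∈ Set.Icc (0 : ℝ) 1, ∀ x' ∈ Set.Icc (0 : ℝ) 1, |w 0 x - w 0 x'| ≤ C₂ * |x - x'|) :
    (∀ t ∈ Set.Icc 0 T, ∀ x ∈ Set.Icc (0 : ℝ) 1, |w t x| ≤ B) ∧
    ∀ t ∈ Set.Icc 0 T, ∀ x ∈ Set.Icc (0 : ℝ) 1, ∀ t' ∈ Set.Icc 0 T, ∀ x' ∈ Set.Icc (0 : ℝ) 1,
      |w t x - w t' x'| ≤
        max (b / c) C₂ * max 1 M * Real.exp (T * L) * (|t - t'| + |x - x'|) := by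
  have hL0 : 0 ≤ L := by
    have := (abs_nonneg _).trans (ha 1 0 0 0)
    simpa using this
  have hcM : c ≤ M := (hac 0 0).trans (haM 0 0)
  have hC₂ : 0 ≤ C₂ := by
    have := (abs_nonneg _).trans (hi' 1 (by simp) 0 (by simp))
    simpa using this
  set m := max (b / c) C₂ with hm
  have hm0 : 0 ≤ m := hC₂.trans (le_max_right _ _)
  have hbm : b ≤ m * c := (div_le_iff₀ hc).1 (le_max_left _ _)
  set Q := m * Real.exp (T * L) with hQ
  have hmQ : m ≤ Q := le_mul_of_one_le_right hm0 (Real.one_le_exp (by positivity))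
  have hQ0 : 0 ≤ Q := by positivity
  refine ⟨fun t ht x hx => ?_, ?_⟩
  · obtain ⟨X, rfl, hX, τ, hτ, hXτ, hor⟩ :=
      exists_characteristic_foot hc ha hac haM le_rfl ht.1 hx.1
    rw [h.eq_along_characteristic hc ha hac haM hw hτ.1 hτ.2 ht.2
      (fun s hs => hX s ⟨hτ.1.trans hs.1, hs.2⟩) hXτ hx.2]
    rcases hor with rfl | h0
    · have := characteristic_increment hac haM hX le_rfl ht.1 le_rfl
      exact hi _ ⟨hXτ, by nlinarith [hx.2, ht.1]⟩
    · rw [h0]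
      exact hb _ ⟨hτ.1, hτ.2.trans ht.2⟩
  -- comparison of a boundary foot with a later position of another characteristic
  have hfoot : ∀ t ∈ Set.Icc 0 T, ∀ X : ℝ → ℝ, (∀ s ∈ Set.Icc 0 t, HasDerivAt X (a s (X s)) s) →
      X t ∈ Set.Icc (0 : ℝ) 1 → ∀ σ ∈ Set.Icc 0 t, 0 ≤ X σ → (σ = 0 ∨ X σ = 0) →
      ∀ τ ∈ Set.Icc σ t, |w τ 0 - w σ (X σ)| ≤ m * X τ := by
    intro t ht X hX hXt σ hσ hXσ hor τ hτ
    have hτT : τ ∈ Set.Icc 0 T := ⟨hσ.1.trans hτ.1, hτ.2.trans ht.2⟩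
    have hσT : σ ∈ Set.Icc 0 T := ⟨hσ.1, hσ.2.trans ht.2⟩
    have hinc := (characteristic_increment hac haM hX hσ.1 hτ.1 hτ.2).1
    have hinc' := (characteristic_increment hac haM hX hσ.1 hσ.2 le_rfl).1
    have hσ1 : X σ ≤ 1 := by nlinarith [hXt.2, hσ.2]
    have h₁ : |w τ 0 - w σ 0| ≤ b * (τ - σ) := by
      have := hb' τ hτT σ hσT
      rwa [abs_of_nonneg (sub_nonneg.2 hτ.1)] at this
    have h₂ : |w σ 0 - w σ (X σ)| ≤ C₂ * X σ := by
      rcases hor with rfl | h0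
      · have := hi' 0 (by simp) (X 0) ⟨hXσ, hσ1⟩
        rwa [zero_sub, abs_neg, abs_of_nonneg hXσ] at this
      · simp [h0]
    calc |w τ 0 - w σ (X σ)| ≤ |w τ 0 - w σ 0| + |w σ 0 - w σ (X σ)| := abs_sub_le _ _ _
      _ ≤ b * (τ - σ) + C₂ * X σ := add_le_add h₁ h₂
      _ ≤ m * c * (τ - σ) + m * X σ := by
        have := sub_nonneg.2 hτ.1
        gcongr
        exact le_max_right _ _
      _ = m * (c * (τ - σ) + X σ) := by ring
      _ ≤ m * X τ := by gcongr; linarith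
  have hspace : ∀ t ∈ Set.Icc 0 T, ∀ x ∈ Set.Icc (0 : ℝ) 1, ∀ x' ∈ Set.Icc (0 : ℝ) 1,
      |w t x - w t x'| ≤ Q * |x - x'| := by
    intro t ht x hx x' hx'
    obtain ⟨X, rfl, hX, τ, hτ, hXτ, hor⟩ :=
      exists_characteristic_foot hc ha hac haM le_rfl ht.1 hx.1
    obtain ⟨Y, rfl, hY, σ, hσ, hYσ, hor'⟩ :=
      exists_characteristic_foot hc ha hac haM le_rfl ht.1 hx'.1
    rw [h.eq_along_characteristic hc ha hac haM hw hτ.1 hτ.2 ht.2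
      (fun s hs => hX s ⟨hτ.1.trans hs.1, hs.2⟩) hXτ hx.2,
      h.eq_along_characteristic hc ha hac haM hw hσ.1 hσ.2 ht.2
      (fun s hs => hY s ⟨hσ.1.trans hs.1, hs.2⟩) hYσ hx'.2]
    have hdist : ∀ s ∈ Set.Icc 0 t, m * |X s - Y s| ≤ Q * |X t - Y t| := by
      intro s hs
      have h₁ := characteristic_dist_le ha hX hY hs
      have h₂ : L * (t - s) ≤ T * L := by nlinarith [hs.1, ht.2]
      calc m * |X s - Y s| ≤ m * (|X t - Y t| * Real.exp (L * (t - s))) := by gcongr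
        _ ≤ m * (|X t - Y t| * Real.exp (T * L)) := by gcongr
        _ = Q * |X t - Y t| := by rw [hQ]; ring
    have hle1 : ∀ Z : ℝ → ℝ, (∀ s ∈ Set.Icc 0 t, HasDerivAt Z (a s (Z s)) s) → Z t ≤ 1 →
        Z 0 ≤ 1 := by
      intro Z hZ hZ1
      have := (characteristic_increment hac haM hZ le_rfl ht.1 le_rfl).1
      nlinarith [ht.1]
    rcases le_total σ τ with hστ | hτσ
    · refine le_trans ?_ (hdist τ hτ)
      rcases hor with rfl | h0
      · obtain rfl : σ = 0 := le_antisymm hστ hσ.1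
        refine (hi' _ ⟨hXτ, hle1 X hX hx.2⟩ _ ⟨hYσ, hle1 Y hY hx'.2⟩).trans ?_
        gcongr
        exact le_max_right _ _
      · rw [h0, zero_sub, abs_neg]
        refine (hfoot t ht Y hY hx' σ hσ hYσ hor' τ ⟨hστ, hτ.2⟩).trans ?_
        gcongr
        exact le_abs_self _
    · refine le_trans ?_ (hdist σ hσ)
      rw [abs_sub_comm, abs_sub_comm (X σ)]
      rcases hor' with rfl | h0
      · obtain rfl : τ = 0 := le_antisymm hτσ hτ.1
        refine (hi' _ ⟨hYσ, hle1 Y hY hx'.2⟩ _ ⟨hXτ, hle1 X hX hx.2⟩).trans ?_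
        gcongr
        exact le_max_right _ _
      · rw [h0, zero_sub, abs_neg]
        refine (hfoot t ht X hX hx τ hτ hXτ hor σ ⟨hτσ, hσ.2⟩).trans ?_
        gcongr
        exact le_abs_self _
  have htime : ∀ t ∈ Set.Icc 0 T, ∀ t' ∈ Set.Icc 0 T, t' ≤ t → ∀ x ∈ Set.Icc (0 : ℝ) 1,
      |w t x - w t' x| ≤ Q * M * (t - t') := by
    intro t ht t' ht' htt' x hx
    obtain ⟨X, hXx, hX, τ, hτ, hXτ, hor⟩ :=
      exists_characteristic_foot hc ha hac haM ht'.1 htt' hx.1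
    have hτ0 : 0 ≤ τ := ht'.1.trans hτ.1
    have hwτ := h.eq_along_characteristic hc ha hac haM hw hτ0 hτ.2 ht.2
      (fun s hs => hX s ⟨hτ0.trans hs.1, hs.2⟩) hXτ (hXx ▸ hx.2)
    rw [hXx] at hwτ
    have hinc := characteristic_increment hac haM hX hτ0 hτ.2 le_rfl
    rw [hXx] at hinc
    have hXle : X τ ≤ x := by nlinarith [hinc.1, hτ.2]
    have hQb : b ≤ Q * M := by
      calc b ≤ m * c := hbm
        _ ≤ Q * M := by gcongr
    have h₁ : |w τ (X τ) - w t' (X τ)| ≤ Q * M * (τ - t') := by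
      rcases hor with rfl | h0
      · simp
      · rw [h0]
        refine (hb' τ ⟨hτ0, hτ.2.trans ht.2⟩ t' ht').trans ?_
        rw [abs_of_nonneg (sub_nonneg.2 hτ.1)]
        have := sub_nonneg.2 hτ.1
        gcongr
    have h₂ : |w t' (X τ) - w t' x| ≤ Q * (M * (t - τ)) := by
      refine (hspace t' ht' _ ⟨hXτ, hXle.trans hx.2⟩ x hx).trans ?_
      rw [abs_sub_comm, abs_of_nonneg (sub_nonneg.2 hXle)]
      gcongr
      exact hinc.2
    rw [hwτ]
    calc _ ≤ _ := abs_sub_le _ (w t' (X τ)) _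
      _ ≤ Q * M * (τ - t') + Q * (M * (t - τ)) := add_le_add h₁ h₂
      _ = Q * M * (t - t') := by ring
  intro t ht x hx t' ht' x' hx'
  have htime' : |w t x - w t' x| ≤ Q * M * |t - t'| := by
    rcases le_total t' t with hle | hle
    · rw [abs_of_nonneg (sub_nonneg.2 hle)]
      exact htime t ht t' ht' hle x hx
    · rw [abs_sub_comm, abs_sub_comm t, abs_of_nonneg (sub_nonneg.2 hle)]
      exact htime t' ht' t ht hle x hx
  calc |w t x - w t' x'| ≤ |w t x - w t' x| + |w t' x - w t' x'| := abs_sub_le _ _ _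
    _ ≤ Q * M * |t - t'| + Q * 1 * |x - x'| := by
      rw [mul_one]
      exact add_le_add htime' (hspace t' ht' x hx x' hx')
    _ ≤ Q * max 1 M * |t - t'| + Q * max 1 M * |x - x'| := by
      gcongr
      · exact le_max_right _ _
      · exact le_max_left _ _
    _ = m * max 1 M * Real.exp (T * L) * (|t - t'| + |x - x'|) := by rw [hQ]; ring

/-- The version of `IsTransportSolution.bounds` for functions controlled on the rectangle only. -/
lemma IsTransportSolution.bounds_on {T c L M C B b C₂ : ℝ} {a w : ℝ → ℝ → ℝ} (hT : 0 < T)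
    (hc : 0 < c) (hL : 0 ≤ L)
    (ha : ∀ s ∈ Set.Icc 0 T, ∀ y ∈ Set.Icc (0 : ℝ) 1, ∀ s' ∈ Set.Icc 0 T,
      ∀ y' ∈ Set.Icc (0 : ℝ) 1, |a s y - a s' y'| ≤ L * (|s - s'| + |y - y'|))
    (haM : ∀ s ∈ Set.Icc 0 T, ∀ y ∈ Set.Icc (0 : ℝ) 1, c ≤ a s y ∧ a s y ≤ M)
    (hw : ∀ t ∈ Set.Icc 0 T, ∀ x ∈ Set.Icc (0 : ℝ) 1, ∀ t' ∈ Set.Icc 0 T,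
      ∀ x' ∈ Set.Icc (0 : ℝ) 1, |w t x - w t' x'| ≤ C * (|t - t'| + |x - x'|))
    (h : IsTransportSolution T a w)
    (hb : ∀ t ∈ Set.Icc 0 T, |w t 0| ≤ B) (hi : ∀ x ∈ Set.Icc (0 : ℝ) 1, |w 0 x| ≤ B)
    (hb' : ∀ t ∈ Set.Icc 0 T, ∀ t' ∈ Set.Icc 0 T, |w t 0 - w t' 0| ≤ b * |t - t'|)
    (hi' : ∀ x ∈ Set.Icc (0 : ℝ) 1, ∀ x' ∈ Set.Icc (0 : ℝ) 1, |w 0 x - w 0 x'| ≤ C₂ * |x - x'|) :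
    (∀ t ∈ Set.Icc 0 T, ∀ x ∈ Set.Icc (0 : ℝ) 1, |w t x| ≤ B) ∧
    ∀ t ∈ Set.Icc 0 T, ∀ x ∈ Set.Icc (0 : ℝ) 1, ∀ t' ∈ Set.Icc 0 T, ∀ x' ∈ Set.Icc (0 : ℝ) 1,
      |w t x - w t' x'| ≤
        max (b / c) C₂ * max 1 M * Real.exp (T * L) * (|t - t'| + |x - x'|) := by
  have hC : 0 ≤ C := by
    have := (abs_nonneg _).trans
      (hw 0 ⟨le_rfl, hT.le⟩ 1 (by simp) 0 ⟨le_rfl, hT.le⟩ 0 (by simp))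
    simpa using this
  let k : ℝ → ℝ → ℝ := fun S t => Set.projIcc 0 (max 0 S) (le_max_left _ _) t
  have hkmem : ∀ S, 0 < S → ∀ t, k S t ∈ Set.Icc 0 S := fun S hS t => by
    have := (Set.projIcc 0 (max 0 S) (le_max_left _ _) t).2
    exact ⟨this.1, this.2.trans_eq (max_eq_right hS.le)⟩
  have hkeq : ∀ S, 0 < S → ∀ t ∈ Set.Icc 0 S, k S t = t := fun S hS t ht => by
    have : t ∈ Set.Icc 0 (max 0 S) := by rwa [max_eq_right hS.le]
    simp only [k, Set.projIcc_of_mem _ this]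
  have hklip : ∀ S t t', |k S t - k S t'| ≤ |t - t'| := fun S t t' => by
    simpa [Real.dist_eq, Subtype.dist_eq] using
      (LipschitzWith.projIcc (le_max_left 0 S)).dist_le_mul t t'
  have htr : IsTransportSolution T (fun t x => a (k T t) (k 1 x))
      (fun t x => w (k T t) (k 1 x)) := by
    filter_upwards [h] with p hp hmem
    obtain ⟨wT, wX, h₁, h₂, h₃⟩ := hp hmem
    have e₁ := hkeq T hT p.1 (Set.Ioo_subset_Icc_self hmem.1)
    have e₂ := hkeq 1 one_pos p.2 (Set.Ioo_subset_Icc_self hmem.2)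
    refine ⟨wT, wX, ?_, ?_, ?_⟩
    · refine h₁.congr_of_eventuallyEq ?_
      filter_upwards [Ioo_mem_nhds hmem.1.1 hmem.1.2] with τ hτ
      rw [hkeq T hT τ (Set.Ioo_subset_Icc_self hτ), e₂]
    · refine h₂.congr_of_eventuallyEq ?_
      filter_upwards [Ioo_mem_nhds hmem.2.1 hmem.2.2] with ξ hξ
      rw [hkeq 1 one_pos ξ (Set.Ioo_subset_Icc_self hξ), e₁]
    · simpa only [e₁, e₂] using h₃
  have h00 : k T 0 = 0 := hkeq T hT 0 ⟨le_rfl, hT.le⟩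
  have h01 : k 1 0 = 0 := hkeq 1 one_pos 0 (by simp)
  have hkT := hkeq T hT
  have hk1 := hkeq 1 one_pos
  obtain ⟨r₁, r₂⟩ := htr.bounds (c := c) (L := L) (M := M) (C := C) (B := B) (b := b) (C₂ := C₂)
    hT.le hc
    (fun s y s' y' => (ha _ (hkmem T hT s) _ (hkmem 1 one_pos y) _ (hkmem T hT s') _
      (hkmem 1 one_pos y')).trans
        (mul_le_mul_of_nonneg_left (add_le_add (hklip _ _ _) (hklip _ _ _)) hL))
    (fun s y => (haM _ (hkmem T hT s) _ (hkmem 1 one_pos y)).1)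
    (fun s y => (haM _ (hkmem T hT s) _ (hkmem 1 one_pos y)).2)
    (fun s y s' y' => (hw _ (hkmem T hT s) _ (hkmem 1 one_pos y) _ (hkmem T hT s') _
      (hkmem 1 one_pos y')).trans
        (mul_le_mul_of_nonneg_left (add_le_add (hklip _ _ _) (hklip _ _ _)) hC))
    (fun t ht => by simpa only [hkT t ht, h01] using hb t ht)
    (fun x hx => by simpa only [hk1 x hx, h00] using hi x hx)
    (fun t ht t' ht' => by simpa only [hkT t ht, hkT t' ht', h01] using hb' t ht t' ht')
    (fun x hx x' hx' => by simpa only [hk1 x hx, hk1 x' hx', h00] using hi' x hx x' hx')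
  refine ⟨fun t ht x hx => ?_, fun t ht x hx t' ht' x' hx' => ?_⟩
  · simpa only [hkT t ht, hk1 x hx] using r₁ t ht x hx
  · simpa only [hkT t ht, hk1 x hx, hkT t' ht', hk1 x' hx'] using r₂ t ht x hx t' ht' x' hx'

/-- Solutions of `y' = -K sgn(y) |y|^γ` with `K ≥ 0` decay in absolute value. -/
lemma abs_le_of_hasDerivAt_neg_sign_rpow {K γ : ℝ} (hK : 0 ≤ K) {y : ℝ → ℝ}
    (hy : ∀ t : ℝ, 0 ≤ t → HasDerivAt y (-K * Real.sign (y t) * |y t| ^ γ) t) {t : ℝ}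
    (ht : 0 ≤ t) : |y t| ≤ |y 0| := by
  have hanti : AntitoneOn (fun t => y t ^ 2) (Set.Ici 0) := by
    refine antitoneOn_of_deriv_nonpos (convex_Ici 0)
      (fun s hs => ((hy s hs).continuousAt.pow 2).continuousWithinAt)
      (fun s hs => ((hy s (interior_subset hs)).pow 2).differentiableAt.differentiableWithinAt)
      fun s hs => ?_
    have hd := (hy s (interior_subset hs)).pow 2
    have : deriv (fun t => y t ^ 2) s = _ := hd.deriv
    rw [this]
    have h₁ : 0 ≤ y s * Real.sign (y s) := by
      rcases lt_trichotomy (y s) 0 with h | h | h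
      · rw [Real.sign_of_neg h]; linarith
      · simp [h]
      · rw [Real.sign_of_pos h]; linarith
    have h₂ : 0 ≤ |y s| ^ γ := Real.rpow_nonneg (abs_nonneg _) _
    have := mul_nonneg (mul_nonneg hK h₁) h₂
    norm_num
    linarith
  exact sq_le_sq.1 (hanti (Set.mem_Ici.2 le_rfl) (Set.mem_Ici.2 ht) ht)

/-- Solutions of `y' = -K sgn(y) |y|^γ` are Lipschitz. -/
lemma abs_sub_le_of_hasDerivAt_neg_sign_rpow {K γ R : ℝ} (hK : 0 ≤ K) (hγ : 0 ≤ γ) {y : ℝ → ℝ}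
    (hy : ∀ t : ℝ, 0 ≤ t → HasDerivAt y (-K * Real.sign (y t) * |y t| ^ γ) t) (h0 : |y 0| ≤ R)
    {t t' : ℝ} (ht : 0 ≤ t) (ht' : 0 ≤ t') : |y t - y t'| ≤ K * R ^ γ * |t - t'| := by
  refine (convex_Ici (0 : ℝ)).norm_image_sub_le_of_norm_hasDerivWithin_le
    (fun s hs => (hy s hs).hasDerivWithinAt) (fun s hs => ?_) (Set.mem_Ici.2 ht')
    (Set.mem_Ici.2 ht)
  have hsign : |Real.sign (y s)| ≤ 1 := by
    rcases Real.sign_apply_eq (y s) with h | h | h <;> simp [h]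
  have hpow : |y s| ^ γ ≤ R ^ γ :=
    Real.rpow_le_rpow (abs_nonneg _) ((abs_le_of_hasDerivAt_neg_sign_rpow hK hy hs).trans h0) hγ
  have hpos : 0 ≤ |y s| ^ γ := Real.rpow_nonneg (abs_nonneg _) _
  rw [Real.norm_eq_abs, abs_mul, abs_mul, abs_neg, abs_of_nonneg hK, abs_of_nonneg hpos]
  calc K * |Real.sign (y s)| * |y s| ^ γ ≤ K * 1 * R ^ γ := by gcongr
    _ = K * R ^ γ := by ring

/-- Stability of the domain for the one-sided-control fixed-point operator: under
the smallness conditions `C₃' ≤ C₃` and `C₃'' ≤ C₃`, the map sending `(ũ,ṽ)` to the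
pair `(u,v)` of Lipschitz solutions of the linear transport problems with boundary
data `u(t,0) = h(ṽ(t,0),t)` and `v(t,1) = v_r(t)` maps the set
`D = {(u,v) : ‖u‖_∞ ≤ C₁', ‖v‖_∞ ≤ C₁, u C₃-Lipschitz, v C₃'-Lipschitz}` into
itself. -/
theorem stmt_18 (c K C₁ C₂ C₃ γ T M₁ M₂ Ch D₁ D₂ Cu : ℝ)
    (hc : 0 < c) (hK : 0 < K) (hC₁ : 0 < C₁) (hC₂ : 0 < C₂) (hC₃ : 0 < C₃)
    (hγ0 : 0 < γ) (hγ1 : γ < 1) (hT : 0 < T)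
    (lam mu : ℝ → ℝ → ℝ)
    (hlam_smooth : ContDiff ℝ (⊤ : ℕ∞) (fun p : ℝ × ℝ => lam p.1 p.2))
    (hmu_smooth : ContDiff ℝ (⊤ : ℕ∞) (fun p : ℝ × ℝ => mu p.1 p.2))
    (hspeed : ∀ p q : ℝ, mu p q ≤ -c ∧ c ≤ lam p q)
    -- the boundary function `h = h(v,t)`, with `|h| ≤ Ch`, `D₁`-Lipschitz in `v`
    -- and `D₂`-Lipschitz in `t` on `[-C₁,C₁]×[0,∞)`
    (h : ℝ → ℝ → ℝ)
    (hh_bd : ∀ w ∈ Set.Icc (-C₁) C₁, ∀ t : ℝ, 0 ≤ t → |h w t| ≤ Ch)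
    (hh_D₁ : ∀ w ∈ Set.Icc (-C₁) C₁, ∀ w' ∈ Set.Icc (-C₁) C₁, ∀ t : ℝ, 0 ≤ t →
      |h w t - h w' t| ≤ D₁ * |w - w'|)
    (hh_D₂ : ∀ w ∈ Set.Icc (-C₁) C₁, ∀ t : ℝ, 0 ≤ t → ∀ t' : ℝ, 0 ≤ t' →
      |h w t - h w t'| ≤ D₂ * |t - t'|)
    -- `M₁` bounds `λ, μ` and `M₂` their Lipschitz constants on `[-C₁',C₁']×[-C₁,C₁]`
    (hM₁ : ∀ p ∈ Set.Icc (-(max C₁ Ch)) (max C₁ Ch), ∀ q ∈ Set.Icc (-C₁) C₁,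
      |lam p q| ≤ M₁ ∧ |mu p q| ≤ M₁)
    (hM₂ : ∀ p ∈ Set.Icc (-(max C₁ Ch)) (max C₁ Ch), ∀ q ∈ Set.Icc (-C₁) C₁,
      ∀ p' ∈ Set.Icc (-(max C₁ Ch)) (max C₁ Ch), ∀ q' ∈ Set.Icc (-C₁) C₁,
      |lam p q - lam p' q'| ≤ M₂ * (|p - p'| + |q - q'|) ∧
      |mu p q - mu p' q'| ≤ M₂ * (|p - p'| + |q - q'|))
    -- the smallness conditions `C₃' ≤ C₃` and `C₃'' ≤ C₃`
    (hC₃' : max (K * C₁ ^ γ / c) C₂ * max 1 M₁ * Real.exp (2 * T * M₂ * C₃) ≤ C₃)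
    (hC₃'' : max ((D₁ * (max (K * C₁ ^ γ / c) C₂ * max 1 M₁ *
        Real.exp (2 * T * M₂ * C₃)) + D₂) / c) C₂ * max 1 M₁ *
        Real.exp (2 * T * M₂ * C₃) ≤ C₃)
    -- `(ũ,ṽ)` in the domain `D`
    (ut vt : ℝ → ℝ → ℝ)
    (hut_bd : ∀ t ∈ Set.Icc (0:ℝ) T, ∀ x ∈ Set.Icc (0:ℝ) 1,
      |ut t x| ≤ max C₁ Ch ∧ |vt t x| ≤ C₁)
    (hut_lip : ∀ t ∈ Set.Icc (0:ℝ) T, ∀ x ∈ Set.Icc (0:ℝ) 1,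
      ∀ t' ∈ Set.Icc (0:ℝ) T, ∀ x' ∈ Set.Icc (0:ℝ) 1,
      |ut t x - ut t' x'| ≤ C₃ * (|t - t'| + |x - x'|) ∧
      |vt t x - vt t' x'| ≤
        max (K * C₁ ^ γ / c) C₂ * max 1 M₁ * Real.exp (2 * T * M₂ * C₃) *
          (|t - t'| + |x - x'|))
    -- the initial data, with compatibility condition
    (u0 v0 du0 dv0 : ℝ → ℝ)
    (hu0 : ∀ x ∈ Set.Icc (0:ℝ) 1, HasDerivWithinAt u0 (du0 x) (Set.Icc 0 1) x ∧
      HasDerivWithinAt v0 (dv0 x) (Set.Icc 0 1) x)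
    (hu0_bd : ∀ x ∈ Set.Icc (0:ℝ) 1, |u0 x| ≤ C₁ ∧ |v0 x| ≤ C₁)
    (hdu0_bd : ∀ x ∈ Set.Icc (0:ℝ) 1, |du0 x| ≤ C₂ ∧ |dv0 x| ≤ C₂)
    (hcomp : u0 0 = h (v0 0) 0)
    -- the controlled boundary datum solves the finite-time stable ODE
    (vr : ℝ → ℝ)
    (hvr_ode : ∀ t : ℝ, 0 ≤ t → HasDerivAt vr (-K * Real.sign (vr t) * |vr t| ^ γ) t)
    (hvr0 : vr 0 = v0 1)
    -- `(u,v)` are the Lipschitz solutions of the linear transport problems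
    (u v : ℝ → ℝ → ℝ) (uT uX vT vX : ℝ × ℝ → ℝ)
    (huv_lip : ∀ t ∈ Set.Icc (0:ℝ) T, ∀ x ∈ Set.Icc (0:ℝ) 1,
      ∀ t' ∈ Set.Icc (0:ℝ) T, ∀ x' ∈ Set.Icc (0:ℝ) 1,
      |u t x - u t' x'| ≤ Cu * (|t - t'| + |x - x'|) ∧
      |v t x - v t' x'| ≤ Cu * (|t - t'| + |x - x'|))
    (hpde : ∀ᵐ p : ℝ × ℝ ∂(volume.restrict (Set.Ioo (0:ℝ) T ×ˢ Set.Ioo (0:ℝ) 1)),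
      HasDerivAt (fun τ => u τ p.2) (uT p) p.1 ∧
      HasDerivAt (fun ξ => u p.1 ξ) (uX p) p.2 ∧
      HasDerivAt (fun τ => v τ p.2) (vT p) p.1 ∧
      HasDerivAt (fun ξ => v p.1 ξ) (vX p) p.2 ∧
      uT p + lam (ut p.1 p.2) (vt p.1 p.2) * uX p = 0 ∧
      vT p + mu (ut p.1 p.2) (vt p.1 p.2) * vX p = 0)
    (hbc : ∀ t ∈ Set.Icc (0:ℝ) T, u t 0 = h (vt t 0) t ∧ v t 1 = vr t)
    (hic : ∀ x ∈ Set.Icc (0:ℝ) 1, u 0 x = u0 x ∧ v 0 x = v0 x) :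
    (∀ t ∈ Set.Icc (0:ℝ) T, ∀ x ∈ Set.Icc (0:ℝ) 1,
      |u t x| ≤ max C₁ Ch ∧ |v t x| ≤ C₁) ∧
    (∀ t ∈ Set.Icc (0:ℝ) T, ∀ x ∈ Set.Icc (0:ℝ) 1,
      ∀ t' ∈ Set.Icc (0:ℝ) T, ∀ x' ∈ Set.Icc (0:ℝ) 1,
      |u t x - u t' x'| ≤ C₃ * (|t - t'| + |x - x'|) ∧
      |v t x - v t' x'| ≤
        max (K * C₁ ^ γ / c) C₂ * max 1 M₁ * Real.exp (2 * T * M₂ * C₃) *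
          (|t - t'| + |x - x'|)) := by
  set C₃' := max (K * C₁ ^ γ / c) C₂ * max 1 M₁ * Real.exp (2 * T * M₂ * C₃) with hC₃'def
  have h0T : (0 : ℝ) ∈ Set.Icc 0 T := ⟨le_rfl, hT.le⟩
  have h01 : (0 : ℝ) ∈ Set.Icc (0 : ℝ) 1 := by simp
  have h11 : (1 : ℝ) ∈ Set.Icc (0 : ℝ) 1 := by simp
  have hmax : 0 < max C₁ Ch := lt_max_of_lt_left hC₁
  have hD₁ : 0 ≤ D₁ := by
    have := (abs_nonneg _).trans
      (hh_D₁ C₁ ⟨by linarith, le_rfl⟩ 0 ⟨by linarith, hC₁.le⟩ 0 le_rfl)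
    rw [sub_zero, abs_of_pos hC₁] at this
    exact nonneg_of_mul_nonneg_left this hC₁
  have hM₂0 : 0 ≤ M₂ := by
    have := (abs_nonneg _).trans (hM₂ 0 ⟨by linarith, hmax.le⟩ C₁ ⟨by linarith, le_rfl⟩
      0 ⟨by linarith, hmax.le⟩ 0 ⟨by linarith, hC₁.le⟩).1
    rw [sub_zero, sub_zero, abs_zero, zero_add, abs_of_pos hC₁] at this
    exact nonneg_of_mul_nonneg_left this hC₁
  have hL : 0 ≤ 2 * M₂ * C₃ := by positivity
  have hexp : T * (2 * M₂ * C₃) = 2 * T * M₂ * C₃ := by ring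
  have hmem : ∀ t ∈ Set.Icc (0 : ℝ) T, ∀ x ∈ Set.Icc (0 : ℝ) 1,
      ut t x ∈ Set.Icc (-(max C₁ Ch)) (max C₁ Ch) ∧ vt t x ∈ Set.Icc (-C₁) C₁ :=
    fun t ht x hx => ⟨abs_le.1 (hut_bd t ht x hx).1, abs_le.1 (hut_bd t ht x hx).2⟩
  -- the speeds are Lipschitz along `(ũ,ṽ)`
  have hspeed_lip : ∀ t ∈ Set.Icc (0 : ℝ) T, ∀ x ∈ Set.Icc (0 : ℝ) 1, ∀ t' ∈ Set.Icc (0 : ℝ) T,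
      ∀ x' ∈ Set.Icc (0 : ℝ) 1,
      M₂ * (|ut t x - ut t' x'| + |vt t x - vt t' x'|) ≤
        2 * M₂ * C₃ * (|t - t'| + |x - x'|) := by
    intro t ht x hx t' ht' x' hx'
    obtain ⟨h₁, h₂⟩ := hut_lip t ht x hx t' ht' x' hx'
    calc M₂ * (|ut t x - ut t' x'| + |vt t x - vt t' x'|)
        ≤ M₂ * (C₃ * (|t - t'| + |x - x'|) + C₃ * (|t - t'| + |x - x'|)) := by
          gcongr
          exact h₂.trans (by gcongr)
      _ = 2 * M₂ * C₃ * (|t - t'| + |x - x'|) := by ring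
  have hpde' : ∀ᵐ p : ℝ × ℝ, p ∈ Set.Ioo (0 : ℝ) T ×ˢ Set.Ioo (0 : ℝ) 1 → _ :=
    (ae_restrict_iff' (measurableSet_Ioo.prod measurableSet_Ioo)).1 hpde
  have hu_tr : IsTransportSolution T (fun t x => lam (ut t x) (vt t x)) u := by
    filter_upwards [hpde'] with p hp hpm
    obtain ⟨h₁, h₂, -, -, h₃, -⟩ := hp hpm
    exact ⟨_, _, h₁, h₂, h₃⟩
  -- the reflection `x ↦ 1 - x` turns the left-going equation into a right-going one
  have hv_tr : IsTransportSolution T (fun t x => -mu (ut t (1 - x)) (vt t (1 - x)))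
      (fun t x => v t (1 - x)) := by
    have hrefl : MeasurePreserving (Prod.map id fun x : ℝ => 1 - x) (volume.prod volume)
        (volume.prod volume) :=
      (MeasurePreserving.id (volume : Measure ℝ)).prod
        (Measure.measurePreserving_sub_left (volume : Measure ℝ) 1)
    filter_upwards [hrefl.quasiMeasurePreserving.ae hpde'] with p hp hpm
    obtain ⟨-, -, h₁, h₂, -, h₃⟩ := hp
      ⟨hpm.1, ⟨by simp only [Prod.map]; linarith [hpm.2.2],
        by simp only [Prod.map]; linarith [hpm.2.1]⟩⟩
    refine ⟨_, -vX (Prod.map id (fun x : ℝ => 1 - x) p), h₁, ?_, ?_⟩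
    · have := h₂.comp p.2 ((hasDerivAt_id p.2).const_sub 1)
      simpa [Function.comp_def] using this
    · rw [neg_mul_neg]
      exact h₃
  have hu0lip : ∀ x ∈ Set.Icc (0 : ℝ) 1, ∀ x' ∈ Set.Icc (0 : ℝ) 1,
      |u0 x - u0 x'| ≤ C₂ * |x - x'| := fun x hx x' hx' =>
    (convex_Icc (0 : ℝ) 1).norm_image_sub_le_of_norm_hasDerivWithin_le
      (fun y hy => (hu0 y hy).1) (fun y hy => (hdu0_bd y hy).1) hx' hx
  have hv0lip : ∀ x ∈ Set.Icc (0 : ℝ) 1, ∀ x' ∈ Set.Icc (0 : ℝ) 1,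
      |v0 x - v0 x'| ≤ C₂ * |x - x'| := fun x hx x' hx' =>
    (convex_Icc (0 : ℝ) 1).norm_image_sub_le_of_norm_hasDerivWithin_le
      (fun y hy => (hu0 y hy).2) (fun y hy => (hdu0_bd y hy).2) hx' hx
  have hvr0' : |vr 0| ≤ C₁ := hvr0 ▸ (hu0_bd 1 h11).2
  have hr : ∀ x ∈ Set.Icc (0 : ℝ) 1, 1 - x ∈ Set.Icc (0 : ℝ) 1 := fun x hx =>
    ⟨by linarith [hx.2], by linarith [hx.1]⟩
  have hr' : ∀ x x' : ℝ, |1 - x - (1 - x')| = |x - x'| := fun x x' => by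
    rw [sub_sub_sub_cancel_left, abs_sub_comm]
  have hub := hu_tr.bounds_on (c := c) (L := 2 * M₂ * C₃) (M := M₁) (C := Cu) (B := max C₁ Ch)
    (b := D₁ * C₃' + D₂) (C₂ := C₂) hT hc hL
    (fun t ht x hx t' ht' x' hx' => (hM₂ _ (hmem t ht x hx).1 _ (hmem t ht x hx).2 _
      (hmem t' ht' x' hx').1 _ (hmem t' ht' x' hx').2).1.trans
      (hspeed_lip t ht x hx t' ht' x' hx'))
    (fun t ht x hx => ⟨(hspeed _ _).2, (le_abs_self _).trans
      (hM₁ _ (hmem t ht x hx).1 _ (hmem t ht x hx).2).1⟩)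
    (fun t ht x hx t' ht' x' hx' => (huv_lip t ht x hx t' ht' x' hx').1)
    (fun t ht => by
      rw [(hbc t ht).1]
      exact (hh_bd _ (hmem t ht 0 h01).2 t ht.1).trans (le_max_right _ _))
    (fun x hx => by
      rw [(hic x hx).1]
      exact (hu0_bd x hx).1.trans (le_max_left _ _))
    (fun t ht t' ht' => by
      rw [(hbc t ht).1, (hbc t' ht').1]
      have h₁ := hh_D₁ _ (hmem t ht 0 h01).2 _ (hmem t' ht' 0 h01).2 t ht.1
      have h₂ := hh_D₂ _ (hmem t' ht' 0 h01).2 t ht.1 t' ht'.1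
      have h₃ := (hut_lip t ht 0 h01 t' ht' 0 h01).2
      rw [sub_self, abs_zero, add_zero] at h₃
      calc _ ≤ _ := abs_sub_le _ (h (vt t' 0) t) _
        _ ≤ D₁ * (C₃' * |t - t'|) + D₂ * |t - t'| := by
          refine add_le_add (h₁.trans ?_) h₂
          gcongr
        _ = (D₁ * C₃' + D₂) * |t - t'| := by ring)
    (fun x hx x' hx' => by
      rw [(hic x hx).1, (hic x' hx').1]
      exact hu0lip x hx x' hx')
  have hvb := hv_tr.bounds_on (c := c) (L := 2 * M₂ * C₃) (M := M₁) (C := Cu) (B := C₁)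
    (b := K * C₁ ^ γ) (C₂ := C₂) hT hc hL
    (fun t ht x hx t' ht' x' hx' => by
      have hx := hr x hx
      have hx' := hr x' hx'
      rw [neg_sub_neg, abs_sub_comm, ← hr' x x']
      exact (hM₂ _ (hmem t ht _ hx).1 _ (hmem t ht _ hx).2 _ (hmem t' ht' _ hx').1 _
        (hmem t' ht' _ hx').2).2.trans (hspeed_lip t ht _ hx t' ht' _ hx'))
    (fun t ht x hx => ⟨by linarith [(hspeed (ut t (1 - x)) (vt t (1 - x))).1],
      (neg_le_abs _).trans
        (hM₁ _ (hmem t ht _ (hr x hx)).1 _ (hmem t ht _ (hr x hx)).2).2⟩)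
    (fun t ht x hx t' ht' x' hx' => by
      rw [← hr' x x']
      exact (huv_lip t ht _ (hr x hx) t' ht' _ (hr x' hx')).2)
    (fun t ht => by
      rw [sub_zero, (hbc t ht).2]
      exact (abs_le_of_hasDerivAt_neg_sign_rpow hK.le hvr_ode ht.1).trans hvr0')
    (fun x hx => by
      rw [(hic _ (hr x hx)).2]
      exact (hu0_bd _ (hr x hx)).2)
    (fun t ht t' ht' => by
      rw [sub_zero, (hbc t ht).2, (hbc t' ht').2]
      exact abs_sub_le_of_hasDerivAt_neg_sign_rpow hK.le hγ0.le hvr_ode hvr0' ht.1 ht'.1)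
    (fun x hx x' hx' => by
      rw [(hic _ (hr x hx)).2, (hic _ (hr x' hx')).2, ← hr' x x']
      exact hv0lip _ (hr x hx) _ (hr x' hx'))
  rw [hexp] at hub hvb
  refine ⟨fun t ht x hx => ⟨hub.1 t ht x hx, ?_⟩,
    fun t ht x hx t' ht' x' hx' => ⟨(hub.2 t ht x hx t' ht' x' hx').trans (by gcongr), ?_⟩⟩
  · simpa only [sub_sub_cancel] using hvb.1 t ht (1 - x) (hr x hx)
  · simpa only [sub_sub_cancel, hr'] using
      hvb.2 t ht (1 - x) (hr x hx) t' ht' (1 - x') (hr x' hx')
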